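/- Let (X, d, μ) be a metric measure space whose measure is Ahlfors ν-regular with constants 0 < c₁ ≤ c₂ < ∞ satisfying 2^{1−ν}·(c₂/c₁) < 1, and let K be a kernel satisfying the size condition and the pseudo-radial null condition. Let f : X → ℝ be locally integrable and let g : X → [0,∞] be locally integrable such that the pair (f, g) satisfies a weak (1, ρ')-Poincaré–Sobolev inequality for some 1 < ρ' < ν. Suppose g belongs to the Morrey space M^{p,q}_μ(X) for some 1 < p ≤ q < ∞ with q/ν < 1, and define p₁ = p/(1 − q/ν) and q₁ = q/(1 − q/ν). Then there is a constant C such that ‖T*_K f‖_{M^{p₁,q₁}} ≤ C · ‖g‖_{M^{p,q}}. -/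

import Mathlib

open MeasureTheory Metric ENNReal

variable {X : Type*} [MetricSpace X] [MeasurableSpace X] [BorelSpace X]

/-- Riesz-type potential `R_{s,μ} g (x) = ∫ d(x,y)^s / μ(B(x,d(x,y))) · g(y) dμ(y)`,
for `g : X → [0,∞]`, valued in `[0,∞]`. -/
noncomputable def rieszPot (μ : Measure X) (s : ℝ) (g : X → ℝ≥0∞) (x : X) : ℝ≥0∞ :=
  ∫⁻ y, (ENNReal.ofReal (dist x y ^ s) / μ (ball x (dist x y))) * g y ∂μ

/-- Riesz-type potential applied to a real (signed) function, as a Bochner integral. -/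
noncomputable def rieszR (μ : Measure X) (s : ℝ) (f : X → ℝ) (x : X) : ℝ :=
  ∫ y, (dist x y ^ s / (μ (ball x (dist x y))).toReal) * f y ∂μ

/-- Hardy–Littlewood maximal function: sup over open balls containing `x`. -/
noncomputable def maximalFn (μ : Measure X) (g : X → ℝ≥0∞) (x : X) : ℝ≥0∞ :=
  ⨆ (z : X) (r : ℝ) (_ : 0 < r) (_ : x ∈ ball z r),
    (μ (ball z r))⁻¹ * ∫⁻ y in ball z r, g y ∂μ

/-- Morrey norm `‖g‖_{M^{p,q}}`, valued in `[0,∞]`. -/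
noncomputable def morreyNorm (μ : Measure X) (p q : ℝ) (g : X → ℝ≥0∞) : ℝ≥0∞ :=
  ⨆ (z : X) (r : ℝ) (_ : 0 < r),
    (μ (ball z r) ^ (p / q - 1) * ∫⁻ y in ball z r, g y ^ p ∂μ) ^ (1 / p)

/-- Truncated singular integral `T^ε_K f (x)`. -/
noncomputable def truncT (μ : Measure X) (K : X → X → ℝ) (f : X → ℝ) (ε : ℝ) (x : X) : ℝ :=
  ∫ y in {y | ε < dist x y}, K x y * f y ∂μ

/-- Maximal singular operator `T^*_K f (x) = sup_{ε>0} |T^ε_K f (x)|`, valued in `[0,∞]`. -/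
noncomputable def maxT (μ : Measure X) (K : X → X → ℝ) (f : X → ℝ) (x : X) : ℝ≥0∞ :=
  ⨆ (ε : ℝ) (_ : 0 < ε), ENNReal.ofReal |truncT μ K f ε x|

/-- Ahlfors `ν`-regularity: `c₁ r^ν ≤ μ(B(x,r)) ≤ c₂ r^ν`. -/
def IsAhlfors (μ : Measure X) (c₁ c₂ ν : ℝ) : Prop :=
  ∀ (x : X) (r : ℝ), 0 < r →
    ENNReal.ofReal (c₁ * r ^ ν) ≤ μ (ball x r) ∧ μ (ball x r) ≤ ENNReal.ofReal (c₂ * r ^ ν)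

/-- Size condition on the kernel: `|K(x,y)| ≤ C_K / d(x,y)^ν` for `x ≠ y`. -/
def SizeCond (K : X → X → ℝ) (CK ν : ℝ) : Prop :=
  ∀ x y : X, x ≠ y → |K x y| ≤ CK / dist x y ^ ν

/-- Pseudo-radial null condition: `∫_{a < d(x,y) < b} K(x,y) dμ(y) = 0`. -/
def NullCond (μ : Measure X) (K : X → X → ℝ) : Prop :=
  ∀ (x : X) (a b : ℝ), 0 < a → a < b →
    ∫ y in {y | a < dist x y ∧ dist x y < b}, K x y ∂μ = 0

/-- Weak `(1,ρ')`-Poincaré–Sobolev inequality for the pair `(f,g)` with constants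
`C_P > 0` and dilation `σ`. -/
def PoincareSobolev (μ : Measure X) (f : X → ℝ) (g : X → ℝ≥0∞) (ρ' CP σ : ℝ) : Prop :=
  ∀ (x : X) (r : ℝ), 0 < r →
    ((μ (ball x r))⁻¹ *
        ∫⁻ y in ball x r, ENNReal.ofReal (|f y - ⨍ z in ball x r, f z ∂μ| ^ ρ') ∂μ) ^ (1 / ρ')
      ≤ ENNReal.ofReal (CP * r) *
        ((μ (ball x (σ * r)))⁻¹ * ∫⁻ y in ball x (σ * r), g y ∂μ)

/-- Local integrability for an `[0,∞]`-valued function: measurable with finite integral on balls. -/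
def LocIntE (μ : Measure X) (g : X → ℝ≥0∞) : Prop :=
  Measurable g ∧ ∀ (z : X) (r : ℝ), ∫⁻ y in ball z r, g y ∂μ < ∞

/-- `L^r` norm (in `[0,∞]`) of an `[0,∞]`-valued function. -/
noncomputable def lpNormE (μ : Measure X) (r : ℝ) (h : X → ℝ≥0∞) : ℝ≥0∞ :=
  (∫⁻ x, h x ^ r ∂μ) ^ (1 / r)

/-- Lorentz `L^{r,m}` quasinorm (in `[0,∞]`) of an `[0,∞]`-valued function. -/
noncomputable def lorentzNormE (μ : Measure X) (r m : ℝ) (h : X → ℝ≥0∞) : ℝ≥0∞ :=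
  ENNReal.ofReal (r ^ (1 / m)) *
    (∫⁻ α in Set.Ioi (0 : ℝ),
        (ENNReal.ofReal α * μ {x | ENNReal.ofReal α < h x} ^ (1 / r)) ^ m *
          ENNReal.ofReal α⁻¹) ^ (1 / m)

set_option linter.unusedSectionVars false

section DyadicSums

theorem tsum_pow_natAbs_lt_top {r : ℝ≥0∞} (hr : r < 1) : ∑' i : ℤ, r ^ i.natAbs < ∞ := by
  rw [tsum_of_nat_of_neg_add_one ENNReal.summable ENNReal.summable]
  refine ENNReal.add_lt_top.2 ⟨?_, ?_⟩
  · simpa using tsum_geometric_lt_top.2 hr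
  · refine lt_of_le_of_lt (ENNReal.tsum_le_tsum fun n => ?_) (tsum_geometric_lt_top.2 hr)
    have : (-((n : ℤ) + 1)).natAbs = n + 1 := by omega
    rw [this]
    exact pow_le_pow_right_of_le_one' hr.le n.le_succ

theorem tsum_pow_natAbs_sub (r : ℝ≥0∞) (n : ℤ) :
    ∑' k : ℤ, r ^ (n - k).natAbs = ∑' i : ℤ, r ^ i.natAbs :=
  (Equiv.subLeft n).tsum_eq fun i : ℤ => r ^ i.natAbs

theorem two_zpow_sub_rpow (n : ℤ) (m : ℕ) (s : ℝ) :
    ((2 : ℝ≥0∞) ^ (n - m)) ^ s = ((2 : ℝ≥0∞) ^ n) ^ s * (2 ^ (-s)) ^ m := by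
  rw [← ENNReal.rpow_intCast, ← ENNReal.rpow_intCast, ← ENNReal.rpow_natCast, ← ENNReal.rpow_mul,
    ← ENNReal.rpow_mul, ← ENNReal.rpow_mul, ← ENNReal.rpow_add _ _ two_ne_zero ofNat_ne_top]
  congr 1
  push_cast
  ring

/-- A power is dominated by the sum of its dyadic level sets. -/
theorem rpow_le_tsum_dyadic {p : ℝ} (hp : 0 < p) (a : ℝ≥0∞) :
    a ^ p ≤ ∑' k : ℤ, {b : ℝ≥0∞ | 2 ^ k + 2 ^ k < b}.indicator
      (fun _ => ((2 : ℝ≥0∞) ^ (k + 2)) ^ p) a := by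
  rcases eq_or_ne a 0 with rfl | ha
  · simp [hp]
  have hdouble : ∀ k : ℤ, (2 : ℝ≥0∞) ^ k + 2 ^ k = 2 ^ (k + 1) := fun k => by
    rw [ENNReal.zpow_add two_ne_zero ofNat_ne_top, zpow_one, mul_two]
  simp only [hdouble]
  rcases eq_or_ne a ∞ with rfl | ha'
  · have h1 : ∑' k : ℕ, (1 : ℝ≥0∞) = ∞ := ENNReal.tsum_const_eq_top_of_ne_zero one_ne_zero
    refine le_top.trans (h1.symm.le.trans ?_)
    refine le_trans ?_ (ENNReal.tsum_comp_le_tsum_of_injective Nat.cast_injective _)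
    refine ENNReal.tsum_le_tsum fun k => ?_
    rw [Set.indicator_of_mem]
    · refine ENNReal.one_le_rpow ?_ hp
      exact_mod_cast one_le_pow₀ (M₀ := ℝ≥0∞) (n := k + 2) one_le_two
    · exact ENNReal.zpow_lt_top two_ne_zero ofNat_ne_top _
  · obtain ⟨n, hn, hn'⟩ := ENNReal.exists_mem_Ioc_zpow ha ha' one_lt_two ofNat_ne_top
    refine le_trans ?_ (ENNReal.le_tsum (n - 1))
    rw [Set.indicator_of_mem (by simpa using hn)]
    gcongr
    rwa [show n - 1 + 2 = n + 1 by ring]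

theorem tsum_dyadic_mul_le {p : ℝ} (hp : 1 < p) (b : ℝ≥0∞) :
    ∑' k : ℤ, ((2 : ℝ≥0∞) ^ k) ^ (p - 1) * {b : ℝ≥0∞ | 2 ^ k < b}.indicator id b ≤
      (∑' i : ℤ, ((2 : ℝ≥0∞) ^ (-(p - 1))) ^ i.natAbs) * b ^ p := by
  rcases eq_or_ne b 0 with rfl | hb
  · simp
  rcases eq_or_ne b ∞ with rfl | hb'
  · rw [ENNReal.top_rpow_of_pos (by linarith), ENNReal.mul_top]
    · exact le_top
    · intro h
      simpa using ENNReal.tsum_eq_zero.1 h 0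
  obtain ⟨n, hn, hn'⟩ := ENNReal.exists_mem_Ioc_zpow hb hb' one_lt_two ofNat_ne_top
  rw [← tsum_pow_natAbs_sub _ n, ← ENNReal.tsum_mul_right]
  refine ENNReal.tsum_le_tsum fun k => ?_
  by_cases hk : (2 : ℝ≥0∞) ^ k < b
  · have hkn : k ≤ n := by
      by_contra! h
      exact absurd (hk.trans_le hn') (not_lt.2 (ENNReal.zpow_le_of_le one_le_two h))
    obtain ⟨m, rfl⟩ : ∃ m : ℕ, k = n - m := ⟨(n - k).toNat, by omega⟩
    rw [Set.indicator_of_mem (by exact hk), two_zpow_sub_rpow]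
    have hb1 : b ^ p = b ^ (p - 1) * b := by
      conv_rhs => rw [← ENNReal.rpow_one b, ← ENNReal.rpow_mul, one_mul,
        ← ENNReal.rpow_add _ _ hb hb', sub_add_cancel]
    have : (n - (n - (m : ℤ))).natAbs = m := by omega
    rw [this, hb1, id, mul_comm (((2 : ℝ≥0∞) ^ n) ^ (p - 1)), mul_assoc]
    gcongr
  · rw [Set.indicator_of_notMem (by exact hk), mul_zero]
    exact zero_le

/-- Interpolation of a dyadic sum between a bound for the small scales and one for the large
scales. -/
theorem exists_tsum_dyadic_le {a : ℝ} (ha : 1 < a) :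
    ∃ C : ℝ≥0∞, C < ∞ ∧ ∀ (A : ℕ → ℝ≥0∞) (m M t : ℝ≥0∞), M ≠ ∞ → t ≠ 0 → t ≠ ∞ →
      (∀ j, A j ≤ m) → (∀ j, A j ≤ M * (2 ^ j * t) ^ (-a)) →
      ∑' j, 2 ^ j * t * A j ≤ C * (m ^ (1 - 1 / a) * M ^ (1 / a)) := by
  have ha0 : 0 < a := by linarith
  have ha1 : 0 < 1 - 1 / a := by rw [sub_pos, div_lt_one ha0]; exact ha
  set r : ℝ≥0∞ := max (2 ^ (-1 : ℝ)) (2 ^ (1 - a))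
  have hr : r < 1 := max_lt (ENNReal.rpow_lt_one_of_one_lt_of_neg one_lt_two (by norm_num))
    (ENNReal.rpow_lt_one_of_one_lt_of_neg one_lt_two (by linarith))
  refine ⟨2 * ∑' i : ℤ, r ^ i.natAbs,
    ENNReal.mul_lt_top ofNat_lt_top (tsum_pow_natAbs_lt_top hr), ?_⟩
  intro A m M t hM ht0 ht1 hAm hAM
  rcases eq_or_ne M 0 with rfl | hM0
  · have : ∀ j, A j = 0 := fun j => by simpa using hAM j
    simp [this]
  rcases eq_or_ne m 0 with rfl | hm0
  · have : ∀ j, A j = 0 := fun j => by simpa using hAm j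
    simp [this]
  rcases eq_or_ne m ∞ with rfl | hm1
  · rw [ENNReal.top_rpow_of_pos ha1, ENNReal.top_mul, ENNReal.mul_top]
    · exact le_top
    · refine mul_ne_zero two_ne_zero fun h => ?_
      simpa using ENNReal.tsum_eq_zero.1 h 0
    · simp [hM0, hM]
  set D : ℝ≥0∞ := (M / m) ^ (1 / a)
  have hMm0 : M / m ≠ 0 := (ENNReal.div_pos hM0 hm1).ne'
  have hMm1 : M / m ≠ ∞ := (ENNReal.div_lt_top hM hm0).ne
  have hD0 : D ≠ 0 := (ENNReal.rpow_pos (pos_iff_ne_zero.2 hMm0) hMm1).ne'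
  have hD1 : D ≠ ∞ := ENNReal.rpow_ne_top_of_nonneg (by positivity) hMm1
  have hDm : D * m = m ^ (1 - 1 / a) * M ^ (1 / a) := by
    rw [ENNReal.rpow_sub _ _ hm0 hm1, ENNReal.rpow_one]
    simp only [D]
    rw [ENNReal.div_rpow_of_nonneg _ _ (by positivity)]
    simp only [div_eq_mul_inv]
    ring
  have hMD : M * D ^ (1 - a) = D * m := by
    have hDa : D ^ (-a) = m / M := by
      simp only [D]
      rw [← ENNReal.rpow_mul, mul_neg, one_div_mul_cancel ha0.ne', ENNReal.rpow_neg_one,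
        ENNReal.inv_div (Or.inl hm1) (Or.inl hm0)]
    rw [sub_eq_add_neg, ENNReal.rpow_add _ _ hD0 hD1, ENNReal.rpow_one, hDa, mul_left_comm,
      ENNReal.mul_div_cancel hM0 hM]
  obtain ⟨n, hn, hn'⟩ := ENNReal.exists_mem_Ioc_zpow (ENNReal.div_pos ht0 hD1).ne'
    (ENNReal.div_lt_top ht1 hD0).ne one_lt_two ofNat_ne_top
  have hzpow : ∀ i j : ℤ, (2 : ℝ≥0∞) ^ (i + j) = 2 ^ i * 2 ^ j :=
    fun i j => ENNReal.zpow_add two_ne_zero ofNat_ne_top i j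
  have hlow : ∀ j : ℕ, D * 2 ^ (n + j) ≤ 2 ^ j * t := fun j => by
    rw [ENNReal.lt_div_iff_mul_lt (Or.inl hD0) (Or.inl hD1)] at hn
    calc D * 2 ^ (n + (j : ℤ)) = 2 ^ j * (2 ^ n * D) := by
          rw [hzpow, zpow_natCast]; ring
      _ ≤ _ := by gcongr
  have hup : ∀ j : ℕ, 2 ^ j * t ≤ D * (2 * 2 ^ (n + j)) := fun j => by
    rw [ENNReal.div_le_iff_le_mul (Or.inl hD0) (Or.inl hD1)] at hn'
    calc 2 ^ j * t ≤ 2 ^ j * (2 ^ (n + 1) * D) := by gcongr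
      _ = _ := by rw [hzpow, hzpow, zpow_natCast, zpow_one]; ring
  have hterm : ∀ j : ℕ, 2 ^ j * t * A j ≤ D * m * (2 * r ^ (n + (j : ℤ)).natAbs) := fun j => by
    have htj0 : 2 ^ j * t ≠ 0 := mul_ne_zero (by simp) ht0
    have htj1 : 2 ^ j * t ≠ ∞ := ENNReal.mul_ne_top (by simp) ht1
    rcases le_total 0 (n + (j : ℤ)) with h | h
    · obtain ⟨i, hi⟩ := Int.eq_ofNat_of_zero_le h
      have hlow := hlow j
      rw [hi] at hlow ⊢
      calc 2 ^ j * t * A j ≤ 2 ^ j * t * (M * (2 ^ j * t) ^ (-a)) := by gcongr; exact hAM j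
        _ = M * (2 ^ j * t) ^ (1 - a) := by
          rw [sub_eq_add_neg, ENNReal.rpow_add _ _ htj0 htj1, ENNReal.rpow_one]; ring
        _ ≤ M * (D * 2 ^ (i : ℤ)) ^ (1 - a) := by
          refine mul_le_mul_right ?_ _
          rw [← neg_sub a 1, ENNReal.rpow_neg, ENNReal.rpow_neg]
          exact ENNReal.inv_le_inv.2 (ENNReal.rpow_le_rpow hlow (by linarith))
        _ = D * m * (1 * (2 ^ (1 - a)) ^ i) := by
          rw [ENNReal.mul_rpow_of_ne_top hD1 (by simp), ← mul_assoc, hMD, zpow_natCast, one_mul,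
            ← ENNReal.rpow_natCast, ← ENNReal.rpow_natCast, ← ENNReal.rpow_mul, ← ENNReal.rpow_mul,
            mul_comm (i : ℝ)]
        _ ≤ _ := by
          rw [Int.natAbs_natCast]
          gcongr
          · exact one_le_two
          · exact le_max_right _ _
    · obtain ⟨i, hi⟩ := Int.eq_ofNat_of_zero_le (neg_nonneg.2 h)
      have hi' : n + (j : ℤ) = 0 - i := by omega
      have hup := hup j
      rw [hi'] at hup ⊢
      have h2 : (2 : ℝ≥0∞) ^ (0 - (i : ℤ)) = (2 ^ (-1 : ℝ)) ^ i := by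
        have := two_zpow_sub_rpow 0 i 1
        simpa using this
      calc 2 ^ j * t * A j ≤ D * (2 * 2 ^ (0 - (i : ℤ))) * m := by gcongr; exact hAm j
        _ = D * m * (2 * (2 ^ (-1 : ℝ)) ^ i) := by rw [h2]; ring
        _ ≤ _ := by
          rw [zero_sub, Int.natAbs_neg, Int.natAbs_natCast]
          gcongr
          exact le_max_left _ _
  calc ∑' j, 2 ^ j * t * A j ≤ ∑' j : ℕ, D * m * (2 * r ^ (n + (j : ℤ)).natAbs) :=
        ENNReal.tsum_le_tsum hterm
    _ = D * m * (2 * ∑' j : ℕ, r ^ (n + (j : ℤ)).natAbs) := by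
        rw [ENNReal.tsum_mul_left, ENNReal.tsum_mul_left]
    _ ≤ D * m * (2 * ∑' i : ℤ, r ^ i.natAbs) := by
        gcongr
        exact ENNReal.tsum_comp_le_tsum_of_injective
          (f := fun j : ℕ => n + (j : ℤ)) (fun i j hij => by simpa using hij)
          (fun i : ℤ => r ^ i.natAbs)
    _ = _ := by rw [hDm, mul_comm]

end DyadicSums

section Ahlfors

variable {μ : Measure X} {c₁ c₂ ν : ℝ}

theorem IsAhlfors.measure_ball_pos (hA : IsAhlfors μ c₁ c₂ ν) (hc₁ : 0 < c₁) (x : X) {r : ℝ}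
    (hr : 0 < r) : 0 < μ (ball x r) :=
  lt_of_lt_of_le (by simpa using by positivity) (hA x r hr).1

theorem IsAhlfors.measure_ball_lt_top (hA : IsAhlfors μ c₁ c₂ ν) (x : X) (r : ℝ) :
    μ (ball x r) < ∞ := by
  rcases le_or_gt r 0 with hr | hr
  · simp [ball_eq_empty.2 hr]
  · exact (hA x r hr).2.trans_lt ofReal_lt_top

theorem IsAhlfors.sigmaFinite (hA : IsAhlfors μ c₁ c₂ ν) : SigmaFinite μ := by
  rcases isEmpty_or_nonempty X with h | ⟨⟨x⟩⟩
  · rw [Measure.eq_zero_of_isEmpty μ]; infer_instance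
  · exact ⟨⟨{ set := fun n : ℕ => ball x n
              set_mem := fun _ => trivial
              finite := fun n => hA.measure_ball_lt_top x n
              spanning := iUnion_ball_nat x }⟩⟩

/-- Two balls of comparable radii have comparable measures, whatever their centres. -/
theorem IsAhlfors.measure_ball_mul_le (hA : IsAhlfors μ c₁ c₂ ν) (hc₁ : 0 < c₁) (hc₂ : 0 < c₂)
    (x y : X) {k r : ℝ} (hk : 0 < k) (hr : 0 < r) :
    μ (ball y (k * r)) ≤ ENNReal.ofReal (c₂ * k ^ ν / c₁) * μ (ball x r) := by
  calc μ (ball y (k * r)) ≤ ENNReal.ofReal (c₂ * (k * r) ^ ν) := (hA y _ (by positivity)).2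
    _ = ENNReal.ofReal (c₂ * k ^ ν / c₁) * ENNReal.ofReal (c₁ * r ^ ν) := by
      rw [← ENNReal.ofReal_mul (by positivity), Real.mul_rpow hk.le hr.le]
      congr 1
      field_simp
    _ ≤ _ := by gcongr; exact (hA x r hr).1

/-- Vitali covering argument behind the weak type `(1,1)` inequality. -/
theorem IsAhlfors.mul_measure_le_lintegral (hA : IsAhlfors μ c₁ c₂ ν) (hc₁ : 0 < c₁)
    (hc₂ : 0 < c₂) (hν : 0 < ν) (h : X → ℝ≥0∞) {t : ℝ≥0∞} (ht : t ≠ 0) (ht' : t ≠ ∞) :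
    t * μ {x | ∃ (z : X) (r : ℝ), 0 < r ∧ x ∈ ball z r ∧
        t * μ (ball z r) ≤ ∫⁻ y in ball z r, h y ∂μ} ≤
      ENNReal.ofReal (c₂ * 6 ^ ν / c₁) * ∫⁻ y, h y ∂μ := by
  have := hA.sigmaFinite
  rcases eq_or_ne (∫⁻ y, h y ∂μ) ∞ with hI | hI
  · rw [hI, ENNReal.mul_top]
    · exact le_top
    · simpa using by positivity
  let T : Set (X × ℝ) := {b | 0 < b.2 ∧ t * μ (ball b.1 b.2) ≤ ∫⁻ y in ball b.1 b.2, h y ∂μ}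
  obtain ⟨u, huT, hdisj, hcov⟩ := Vitali.exists_disjoint_subfamily_covering_enlargement_closedBall
    T Prod.fst Prod.snd ((((∫⁻ y, h y ∂μ) / t).toReal / c₁) ^ (1 / ν)) (by
      rintro ⟨z, r⟩ ⟨hr, hb⟩
      simp only at hr hb ⊢
      have h1 : ENNReal.ofReal (c₁ * r ^ ν) ≤ (∫⁻ y, h y ∂μ) / t := by
        rw [ENNReal.le_div_iff_mul_le (Or.inl ht) (Or.inl ht'), mul_comm]
        exact (mul_le_mul_right (hA z r hr).1 t).trans (hb.trans (setLIntegral_le_lintegral _ _))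
      rw [ENNReal.ofReal_le_iff_le_toReal (ENNReal.div_lt_top hI ht).ne] at h1
      calc r = (r ^ ν) ^ (1 / ν) := by
            rw [← Real.rpow_mul hr.le, mul_one_div_cancel hν.ne', Real.rpow_one]
        _ ≤ _ := by
          gcongr
          rw [le_div_iff₀ hc₁, mul_comm]
          exact h1) 5 (by norm_num)
  have hdisj' : u.PairwiseDisjoint fun b => ball b.1 b.2 :=
    hdisj.mono fun b => ball_subset_closedBall
  have hcount : u.Countable := by
    have := Measure.countable_meas_pos_of_disjoint_iUnion (μ := μ)
      (As := fun b : u => ball b.1.1 b.1.2) (fun _ => measurableSet_ball)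
      (fun a b hab => hdisj' a.2 b.2 (fun h => hab (Subtype.ext h)))
    have h2 : {i : u | 0 < μ (ball i.1.1 i.1.2)} = Set.univ :=
      Set.eq_univ_of_forall fun i => hA.measure_ball_pos hc₁ _ (huT i.2).1
    rw [h2] at this
    exact Set.countable_coe_iff.1 (Set.countable_univ_iff.1 this)
  have hsub : {x | ∃ (z : X) (r : ℝ), 0 < r ∧ x ∈ ball z r ∧
        t * μ (ball z r) ≤ ∫⁻ y in ball z r, h y ∂μ} ⊆ ⋃ b ∈ u, ball b.1 (6 * b.2) := by
    rintro x ⟨z, r, hr, hx, hb⟩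
    obtain ⟨b, hbu, hsub⟩ := hcov (z, r) ⟨hr, hb⟩
    refine Set.mem_biUnion hbu (closedBall_subset_ball ?_ (hsub (ball_subset_closedBall hx)))
    have := (huT hbu).1
    linarith
  have := hcount.to_subtype
  calc t * μ _ ≤ t * ∑' b : u, μ (ball b.1.1 (6 * b.1.2)) := by
        gcongr
        exact (measure_mono hsub).trans (measure_biUnion_le μ hcount _)
    _ ≤ t * ∑' b : u, ENNReal.ofReal (c₂ * 6 ^ ν / c₁) * μ (ball b.1.1 b.1.2) := by
        gcongr with b
        exact hA.measure_ball_mul_le hc₁ hc₂ _ _ (by norm_num) (huT b.2).1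
    _ = ENNReal.ofReal (c₂ * 6 ^ ν / c₁) * ∑' b : u, t * μ (ball b.1.1 b.1.2) := by
        rw [ENNReal.tsum_mul_left, ENNReal.tsum_mul_left]; ring
    _ ≤ ENNReal.ofReal (c₂ * 6 ^ ν / c₁) * ∑' b : u, ∫⁻ y in ball b.1.1 b.1.2, h y ∂μ := by
        gcongr with b
        exact (huT b.2).2
    _ = ENNReal.ofReal (c₂ * 6 ^ ν / c₁) * ∫⁻ y in ⋃ b ∈ u, ball b.1 b.2, h y ∂μ := by
        rw [lintegral_biUnion hcount (fun _ _ => measurableSet_ball) hdisj']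
    _ ≤ _ := by gcongr; exact Measure.restrict_le_self

theorem measurable_maximalFn (μ : Measure X) (g : X → ℝ≥0∞) : Measurable (maximalFn μ g) := by
  refine measurable_of_Ioi fun a => IsOpen.measurableSet ?_
  have : maximalFn μ g ⁻¹' Set.Ioi a = ⋃ (z : X) (r : ℝ) (_ : 0 < r)
      (_ : a < (μ (ball z r))⁻¹ * ∫⁻ y in ball z r, g y ∂μ), ball z r := by
    ext x
    simp only [maximalFn, Set.mem_preimage, Set.mem_Ioi, lt_iSup_iff, Set.mem_iUnion]
    grind
  rw [this]
  exact isOpen_iUnion fun z => isOpen_iUnion fun r => isOpen_iUnion fun _ =>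
    isOpen_iUnion fun _ => isOpen_ball

/-- Weak type inequality for the maximal function, in terms of the large values of `g` only. -/
theorem IsAhlfors.mul_measure_lt_maximalFn_le (hA : IsAhlfors μ c₁ c₂ ν) (hc₁ : 0 < c₁)
    (hc₂ : 0 < c₂) (hν : 0 < ν) (g : X → ℝ≥0∞) {t : ℝ≥0∞} (ht : t ≠ 0) (ht' : t ≠ ∞) :
    t * μ {x | t + t < maximalFn μ g x} ≤
      ENNReal.ofReal (c₂ * 6 ^ ν / c₁) * ∫⁻ y, {y | t < g y}.indicator g y ∂μ := by
  refine le_trans ?_ (hA.mul_measure_le_lintegral hc₁ hc₂ hν _ ht ht')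
  gcongr
  intro hx
  simp only [maximalFn, lt_iSup_iff] at hx
  obtain ⟨z, r, hr, hxz, hlt⟩ := hx
  refine ⟨z, r, hr, hxz, ?_⟩
  have hpos := (hA.measure_ball_pos hc₁ z hr).ne'
  have hfin := (hA.measure_ball_lt_top z r).ne
  rw [mul_comm, ← div_eq_mul_inv, ENNReal.lt_div_iff_mul_lt (Or.inl hpos) (Or.inl hfin),
    add_mul] at hlt
  refine (ENNReal.add_le_add_iff_right (ENNReal.mul_ne_top ht' hfin)).1 (hlt.le.trans ?_)
  calc ∫⁻ y in ball z r, g y ∂μ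
      ≤ ∫⁻ y in ball z r, ({y | t < g y}.indicator g y + t) ∂μ := by
        refine lintegral_mono fun y => ?_
        by_cases hy : t < g y
        · simp [Set.indicator, hy]
        · simpa [Set.indicator, hy] using not_lt.1 hy
    _ = _ := by
        rw [lintegral_add_right _ measurable_const, setLIntegral_const]

/-- The Hardy–Littlewood maximal theorem in Ahlfors regular spaces. -/
theorem IsAhlfors.exists_lintegral_maximalFn_rpow_le (hA : IsAhlfors μ c₁ c₂ ν) (hc₁ : 0 < c₁)
    (hc₂ : 0 < c₂) (hν : 0 < ν) {p : ℝ} (hp : 1 < p) :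
    ∃ C : ℝ≥0∞, C < ∞ ∧ ∀ g : X → ℝ≥0∞, Measurable g →
      ∫⁻ x, maximalFn μ g x ^ p ∂μ ≤ C * ∫⁻ x, g x ^ p ∂μ := by
  set D := ENNReal.ofReal (c₂ * 6 ^ ν / c₁)
  set S := ∑' i : ℤ, ((2 : ℝ≥0∞) ^ (-(p - 1))) ^ i.natAbs
  have hS : S < ∞ := tsum_pow_natAbs_lt_top
    (ENNReal.rpow_lt_one_of_one_lt_of_neg one_lt_two (by linarith))
  refine ⟨4 ^ p * D * S, ?_, fun g hg => ?_⟩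
  · exact ENNReal.mul_lt_top (ENNReal.mul_lt_top (by finiteness) ofReal_lt_top) hS
  have hM := measurable_maximalFn μ g
  have hset : ∀ k : ℤ, MeasurableSet {x | (2 : ℝ≥0∞) ^ k + 2 ^ k < maximalFn μ g x} :=
    fun k => measurableSet_lt measurable_const hM
  have hset' : ∀ k : ℤ, MeasurableSet {x | (2 : ℝ≥0∞) ^ k < g x} :=
    fun k => measurableSet_lt measurable_const hg
  have hlevel : ∀ k : ℤ, ((2 : ℝ≥0∞) ^ (k + 2)) ^ p *
      μ {x | (2 : ℝ≥0∞) ^ k + 2 ^ k < maximalFn μ g x} ≤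
      4 ^ p * D * (((2 : ℝ≥0∞) ^ k) ^ (p - 1) * ∫⁻ y, {y | 2 ^ k < g y}.indicator g y ∂μ) := by
    intro k
    have h0 : (2 : ℝ≥0∞) ^ k ≠ 0 := (ENNReal.zpow_pos two_ne_zero ofNat_ne_top k).ne'
    have h1 : (2 : ℝ≥0∞) ^ k ≠ ∞ := (ENNReal.zpow_lt_top two_ne_zero ofNat_ne_top k).ne
    have h2 : ((2 : ℝ≥0∞) ^ (k + 2)) ^ p = 4 ^ p * ((2 : ℝ≥0∞) ^ k) ^ (p - 1) * 2 ^ k := by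
      have : ((2 : ℝ≥0∞) ^ k) ^ (p - 1) * 2 ^ k = ((2 : ℝ≥0∞) ^ k) ^ p := by
        conv_lhs => rw [← ENNReal.rpow_one ((2 : ℝ≥0∞) ^ k), ← ENNReal.rpow_mul, one_mul,
          ← ENNReal.rpow_add _ _ h0 h1, sub_add_cancel]
      rw [mul_assoc, this, ← ENNReal.mul_rpow_of_nonneg _ _ (by linarith),
        ENNReal.zpow_add two_ne_zero ofNat_ne_top, mul_comm]
      norm_num
    calc _ = 4 ^ p * ((2 : ℝ≥0∞) ^ k) ^ (p - 1) *
          (2 ^ k * μ {x | (2 : ℝ≥0∞) ^ k + 2 ^ k < maximalFn μ g x}) := by rw [h2]; ring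
      _ ≤ 4 ^ p * ((2 : ℝ≥0∞) ^ k) ^ (p - 1) *
          (D * ∫⁻ y, {y | 2 ^ k < g y}.indicator g y ∂μ) := by
        refine mul_le_mul_right ?_ _
        exact hA.mul_measure_lt_maximalFn_le hc₁ hc₂ hν g h0 h1
      _ = _ := by ring
  calc ∫⁻ x, maximalFn μ g x ^ p ∂μ
      ≤ ∫⁻ x, ∑' k : ℤ, {x | (2 : ℝ≥0∞) ^ k + 2 ^ k < maximalFn μ g x}.indicator
          (fun _ => ((2 : ℝ≥0∞) ^ (k + 2)) ^ p) x ∂μ :=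
        lintegral_mono fun x => rpow_le_tsum_dyadic (by linarith) _
    _ = ∑' k : ℤ, ((2 : ℝ≥0∞) ^ (k + 2)) ^ p *
          μ {x | (2 : ℝ≥0∞) ^ k + 2 ^ k < maximalFn μ g x} := by
        rw [lintegral_tsum fun k => (measurable_const.indicator (hset k)).aemeasurable]
        simp_rw [fun k : ℤ => lintegral_indicator_const (μ := μ) (hset k)]
    _ ≤ ∑' k : ℤ, 4 ^ p * D *
          (((2 : ℝ≥0∞) ^ k) ^ (p - 1) * ∫⁻ y, {y | 2 ^ k < g y}.indicator g y ∂μ) :=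
        ENNReal.tsum_le_tsum hlevel
    _ = 4 ^ p * D * ∫⁻ y, ∑' k : ℤ,
          ((2 : ℝ≥0∞) ^ k) ^ (p - 1) * {y | 2 ^ k < g y}.indicator g y ∂μ := by
        rw [ENNReal.tsum_mul_left, lintegral_tsum fun k =>
          ((hg.indicator (hset' k)).const_mul _).aemeasurable]
        simp_rw [fun k : ℤ => lintegral_const_mul (μ := μ) (((2 : ℝ≥0∞) ^ k) ^ (p - 1))
          (hg.indicator (hset' k))]
    _ ≤ 4 ^ p * D * ∫⁻ y, S * g y ^ p ∂μ := by
        gcongr with y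
        exact tsum_dyadic_mul_le hp (g y)
    _ = _ := by
        rw [lintegral_const_mul _ (hg.pow_const p)]; ring

theorem setLIntegral_rpow_le_morreyNorm (hA : IsAhlfors μ c₁ c₂ ν) (hc₁ : 0 < c₁) {p q : ℝ}
    (hp : 0 < p) (g : X → ℝ≥0∞) (z : X) {r : ℝ} (hr : 0 < r) :
    ∫⁻ y in ball z r, g y ^ p ∂μ ≤ morreyNorm μ p q g ^ p * μ (ball z r) ^ (1 - p / q) := by
  have h0 := (hA.measure_ball_pos hc₁ z hr).ne'
  have h1 := (hA.measure_ball_lt_top z r).ne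
  have h : (μ (ball z r) ^ (p / q - 1) * ∫⁻ y in ball z r, g y ^ p ∂μ) ^ (1 / p) ≤
      morreyNorm μ p q g :=
    le_iSup₂_of_le z r (le_iSup_of_le hr le_rfl)
  rw [one_div, ENNReal.rpow_inv_le_iff hp] at h
  calc ∫⁻ y in ball z r, g y ^ p ∂μ
      = (μ (ball z r) ^ (p / q - 1) * ∫⁻ y in ball z r, g y ^ p ∂μ) *
          μ (ball z r) ^ (1 - p / q) := by
        rw [mul_right_comm, ← ENNReal.rpow_add _ _ h0 h1]
        simp
    _ ≤ _ := by gcongr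

theorem laverage_le_morreyNorm (hA : IsAhlfors μ c₁ c₂ ν) (hc₁ : 0 < c₁) {p q : ℝ}
    (hp : 1 < p) {g : X → ℝ≥0∞} (hg : Measurable g) (z : X) {r : ℝ} (hr : 0 < r) :
    (μ (ball z r))⁻¹ * ∫⁻ y in ball z r, g y ∂μ ≤
      morreyNorm μ p q g * μ (ball z r) ^ (-(1 / q)) := by
  have h0 := (hA.measure_ball_pos hc₁ z hr).ne'
  have h1 := (hA.measure_ball_lt_top z r).ne
  have hp0 : 0 < p := by linarith
  have h2 := ENNReal.lintegral_mul_le_Lp_mul_Lq (μ.restrict (ball z r))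
    (Real.HolderConjugate.conjExponent hp) hg.aemeasurable (g := fun _ => 1) aemeasurable_const
  simp only [Pi.mul_apply, mul_one, ENNReal.one_rpow, lintegral_const, one_mul,
    Measure.restrict_apply MeasurableSet.univ, Set.univ_inter] at h2
  calc (μ (ball z r))⁻¹ * ∫⁻ y in ball z r, g y ∂μ
      ≤ (μ (ball z r))⁻¹ * ((morreyNorm μ p q g ^ p * μ (ball z r) ^ (1 - p / q)) ^ (1 / p) *
          μ (ball z r) ^ (1 / p.conjExponent)) := by
        gcongr
        exact h2.trans (by gcongr; exact setLIntegral_rpow_le_morreyNorm hA hc₁ hp0 g z hr)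
    _ = morreyNorm μ p q g * (μ (ball z r) ^ (-1 : ℝ) * μ (ball z r) ^ ((1 - p / q) * (1 / p)) *
          μ (ball z r) ^ (1 / p.conjExponent)) := by
        rw [ENNReal.mul_rpow_of_nonneg _ _ (by positivity), ← ENNReal.rpow_mul,
          mul_one_div_cancel hp0.ne', ENNReal.rpow_one, ← ENNReal.rpow_mul, ENNReal.rpow_neg_one]
        ring
    _ = _ := by
        rw [← ENNReal.rpow_add _ _ h0 h1, ← ENNReal.rpow_add _ _ h0 h1]
        congr 2
        rw [Real.conjExponent]
        have : p - 1 ≠ 0 := by linarith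
        field_simp
        ring

theorem IsAhlfors.maximalFn_le_max (hA : IsAhlfors μ c₁ c₂ ν) (hc₁ : 0 < c₁) (hc₂ : 0 < c₂)
    {p q : ℝ} (hp : 1 < p) (hq : 0 < q) {g : X → ℝ≥0∞} (hg : Measurable g) {z x : X} {r : ℝ}
    (hr : 0 < r) (hx : x ∈ ball z r) :
    maximalFn μ g x ≤ max (maximalFn μ ((ball z (2 * r)).indicator g) x)
      (morreyNorm μ p q g * (ENNReal.ofReal (c₂ * 2 ^ ν / c₁) ^ (1 / q) *
        μ (ball z r) ^ (-(1 / q)))) := by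
  refine iSup₂_le fun w s => iSup₂_le fun hs hxw => ?_
  by_cases hsub : ball w s ⊆ ball z (2 * r)
  · refine le_max_of_le_left (le_iSup₂_of_le w s (le_iSup₂_of_le hs hxw ?_))
    refine mul_le_mul_right (setLIntegral_congr_fun measurableSet_ball fun y hy => ?_).le _
    simp only [Set.indicator_of_mem (hsub hy)]
  · refine le_max_of_le_right ((laverage_le_morreyNorm (q := q) hA hc₁ hp hg w hs).trans
      (mul_le_mul_right ?_ _))
    obtain ⟨y, hy, hyz⟩ := Set.not_subset.1 hsub
    rw [mem_ball] at hx hxw hy hyz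
    have hrs : r / 2 ≤ s := by
      have := dist_triangle y x z
      have := dist_triangle_right y x w
      linarith
    set D := ENNReal.ofReal (c₂ * 2 ^ ν / c₁)
    have hD : D ≠ 0 := by simpa [D] using by positivity
    have h1 : μ (ball z r) ≤ D * μ (ball w s) := by
      have := hA.measure_ball_mul_le hc₁ hc₂ w z two_pos (half_pos hr)
      rw [mul_div_cancel₀ _ two_ne_zero] at this
      exact this.trans (by gcongr)
    rw [ENNReal.rpow_neg, ENNReal.rpow_neg, ← ENNReal.inv_rpow, ← ENNReal.inv_rpow,
      ← ENNReal.mul_rpow_of_nonneg _ _ (by positivity)]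
    gcongr
    rw [← div_eq_mul_inv, ENNReal.le_div_iff_mul_le
      (Or.inl (hA.measure_ball_pos hc₁ z hr).ne') (Or.inl (hA.measure_ball_lt_top z r).ne), mul_comm,
      ← div_eq_mul_inv]
    exact ENNReal.div_le_of_le_mul h1

theorem IsAhlfors.exists_morreyNorm_maximalFn_le (hA : IsAhlfors μ c₁ c₂ ν) (hc₁ : 0 < c₁)
    (hc₂ : 0 < c₂) (hν : 0 < ν) {p q : ℝ} (hp : 1 < p) (hpq : p ≤ q) :
    ∃ C : ℝ≥0∞, C < ∞ ∧ ∀ g : X → ℝ≥0∞, Measurable g →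
      morreyNorm μ p q (maximalFn μ g) ≤ C * morreyNorm μ p q g := by
  obtain ⟨C, hC, hmax⟩ := hA.exists_lintegral_maximalFn_rpow_le hc₁ hc₂ hν hp
  have hp0 : 0 < p := by linarith
  have hq0 : 0 < q := by linarith
  set D := ENNReal.ofReal (c₂ * 2 ^ ν / c₁)
  have hpq1 : 0 ≤ 1 - p / q := sub_nonneg.2 ((div_le_one hq0).2 hpq)
  refine ⟨(C * D ^ (1 - p / q) + D ^ (p / q)) ^ (1 / p), ?_, fun g hg => ?_⟩
  · have : D ≠ ∞ := ofReal_ne_top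
    have := hC.ne
    have : 0 ≤ p / q := by positivity
    finiteness
  refine iSup₂_le fun z r => iSup_le fun hr => ?_
  set N := morreyNorm μ p q g
  have h0 := (hA.measure_ball_pos hc₁ z hr).ne'
  have h1 := (hA.measure_ball_lt_top z r).ne
  have hnear : ∫⁻ y in ball z r, maximalFn μ ((ball z (2 * r)).indicator g) y ^ p ∂μ ≤
      C * (N ^ p * (D * μ (ball z r)) ^ (1 - p / q)) := by
    calc _ ≤ ∫⁻ y, maximalFn μ ((ball z (2 * r)).indicator g) y ^ p ∂μ :=
          setLIntegral_le_lintegral _ _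
      _ ≤ C * ∫⁻ y, (ball z (2 * r)).indicator g y ^ p ∂μ :=
          hmax _ (hg.indicator measurableSet_ball)
      _ = C * ∫⁻ y in ball z (2 * r), g y ^ p ∂μ := by
          rw [← lintegral_indicator measurableSet_ball]
          congr 2 with y
          by_cases hy : y ∈ ball z (2 * r) <;> simp [Set.indicator, hp0]
      _ ≤ C * (N ^ p * μ (ball z (2 * r)) ^ (1 - p / q)) := by
          gcongr
          exact setLIntegral_rpow_le_morreyNorm hA hc₁ hp0 g z (by positivity)
      _ ≤ _ := by
          gcongr
          exact hA.measure_ball_mul_le hc₁ hc₂ z z two_pos hr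
  have hint : ∫⁻ y in ball z r, maximalFn μ g y ^ p ∂μ ≤
      (C * D ^ (1 - p / q) + D ^ (p / q)) * N ^ p * μ (ball z r) ^ (1 - p / q) := by
    calc _ ≤ ∫⁻ y in ball z r, (maximalFn μ ((ball z (2 * r)).indicator g) y ^ p +
            (N * (D ^ (1 / q) * μ (ball z r) ^ (-(1 / q)))) ^ p) ∂μ := by
          refine setLIntegral_mono' measurableSet_ball fun y hy => ?_
          refine (ENNReal.rpow_le_rpow (hA.maximalFn_le_max hc₁ hc₂ hp hq0 hg hr hy) hp0.le).trans ?_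
          rw [(ENNReal.monotone_rpow_of_nonneg hp0.le).map_max]
          exact max_le_add_of_nonneg zero_le zero_le
      _ ≤ C * (N ^ p * (D * μ (ball z r)) ^ (1 - p / q)) +
            (N * (D ^ (1 / q) * μ (ball z r) ^ (-(1 / q)))) ^ p * μ (ball z r) := by
          rw [lintegral_add_right _ measurable_const, setLIntegral_const]
          gcongr
      _ = C * (N ^ p * (D * μ (ball z r)) ^ (1 - p / q)) +
            N ^ p * (D ^ (p / q) * μ (ball z r) ^ (1 - p / q)) := by
          congr 1
          rw [ENNReal.mul_rpow_of_nonneg _ _ hp0.le, ENNReal.mul_rpow_of_nonneg _ _ hp0.le,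
            ← ENNReal.rpow_mul, ← ENNReal.rpow_mul, mul_assoc, mul_assoc]
          congr 3
          · ring
          · nth_rw 2 [← ENNReal.rpow_one (μ (ball z r))]
            rw [← ENNReal.rpow_add _ _ h0 h1]
            congr 1
            ring
      _ = _ := by
          rw [ENNReal.mul_rpow_of_nonneg _ _ hpq1]
          ring
  calc _ ≤ (μ (ball z r) ^ (p / q - 1) * ((C * D ^ (1 - p / q) + D ^ (p / q)) * N ^ p *
          μ (ball z r) ^ (1 - p / q))) ^ (1 / p) := by gcongr
    _ = ((C * D ^ (1 - p / q) + D ^ (p / q)) * N ^ p *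
          (μ (ball z r) ^ (p / q - 1) * μ (ball z r) ^ (1 - p / q))) ^ (1 / p) := by
        congr 1; ring
    _ = _ := by
        rw [← ENNReal.rpow_add _ _ h0 h1, ENNReal.mul_rpow_of_nonneg _ _ (by positivity),
          ENNReal.mul_rpow_of_nonneg _ _ (by positivity), ← ENNReal.rpow_mul N,
          mul_one_div_cancel hp0.ne']
        simp

theorem measurableSet_annulus (x : X) (a b : ℝ) : MeasurableSet {y | a < dist x y ∧ dist x y ≤ b} :=
  (by fun_prop : Continuous fun y => dist x y).measurable measurableSet_Ioc

theorem annulus_subset_ball {x : X} {a b c : ℝ} (h : b < c) :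
    {y | a < dist x y ∧ dist x y ≤ b} ⊆ ball x c := fun y hy => by
  rw [mem_ball']
  exact hy.2.trans_lt h

theorem SizeCond.abs_le {K : X → X → ℝ} {CK : ℝ} (hsize : SizeCond K CK ν) (hCK : 0 < CK)
    (hν : 0 < ν) {x y : X} {a : ℝ} (ha : 0 < a) (hy : a < dist x y) : |K x y| ≤ CK / a ^ ν :=
  (hsize x y (dist_pos.1 (ha.trans hy))).trans (by gcongr)

theorem IsAhlfors.integrableOn_kernel (hA : IsAhlfors μ c₁ c₂ ν) (hν : 0 < ν) {K : X → X → ℝ}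
    {CK : ℝ} (hK : Measurable (Function.uncurry K)) (hCK : 0 < CK) (hsize : SizeCond K CK ν)
    (x : X) {a : ℝ} (ha : 0 < a) (b : ℝ) :
    IntegrableOn (K x) {y | a < dist x y ∧ dist x y ≤ b} μ := by
  refine .of_bound ((measure_mono (annulus_subset_ball (lt_add_one b))).trans_lt
    (hA.measure_ball_lt_top x _)) hK.of_uncurry_left.aestronglyMeasurable (CK / a ^ ν) ?_
  filter_upwards [ae_restrict_mem (measurableSet_annulus x a b)] with y hy
  exact hsize.abs_le hCK hν ha hy.1

/-- The null condition over half-open annuli. -/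
theorem IsAhlfors.integral_kernel_eq_zero (hA : IsAhlfors μ c₁ c₂ ν) (hν : 0 < ν)
    {K : X → X → ℝ} {CK : ℝ} (hK : Measurable (Function.uncurry K)) (hCK : 0 < CK)
    (hsize : SizeCond K CK ν) (hnull : NullCond μ K) (x : X) {a b : ℝ} (ha : 0 < a) (hab : a < b) :
    ∫ y in {y | a < dist x y ∧ dist x y ≤ b}, K x y ∂μ = 0 := by
  have hopen : MeasurableSet {y | b < dist x y ∧ dist x y < b + 1} :=
    (by fun_prop : Continuous fun y => dist x y).measurable measurableSet_Ioo
  have hunion : {y | a < dist x y ∧ dist x y ≤ b} ∪ {y | b < dist x y ∧ dist x y < b + 1} =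
      {y | a < dist x y ∧ dist x y < b + 1} := by
    ext y
    simp only [Set.mem_union, Set.mem_ofPred_eq]
    grind
  have h := setIntegral_union (f := K x) (μ := μ) (s := {y | a < dist x y ∧ dist x y ≤ b})
    (t := {y | b < dist x y ∧ dist x y < b + 1})
    (Set.disjoint_left.2 fun y hy hy' => absurd hy.2 (not_le.2 hy'.1)) hopen
    (hA.integrableOn_kernel hν hK hCK hsize x ha b)
    ((hA.integrableOn_kernel hν hK hCK hsize x (ha.trans hab) (b + 1)).mono_set
      fun y hy => ⟨hy.1, hy.2.le⟩)
  rw [hunion, hnull x a _ ha (by linarith), hnull x b _ (ha.trans hab) (by linarith),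
    add_zero] at h
  exact h.symm

theorem PoincareSobolev.enorm_integral_annulus_le {f : X → ℝ} {g : X → ℝ≥0∞} {ρ' CP σ : ℝ}
    (hPS : PoincareSobolev μ f g ρ' CP σ) (hA : IsAhlfors μ c₁ c₂ ν) (hc₁ : 0 < c₁) (hc₂ : 0 < c₂)
    (hν : 0 < ν) {K : X → X → ℝ} {CK : ℝ} (hK : Measurable (Function.uncurry K)) (hCK : 0 < CK)
    (hsize : SizeCond K CK ν) (hnull : NullCond μ K) (hρ' : 1 < ρ') (hCP : 0 < CP) (hσ : 1 ≤ σ)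
    (x : X) {s : ℝ} (hs : 0 < s)
    (hint : IntegrableOn (fun y => K x y * f y) {y | s < dist x y ∧ dist x y ≤ 2 * s} μ) :
    ‖∫ y in {y | s < dist x y ∧ dist x y ≤ 2 * s}, K x y * f y ∂μ‖ₑ ≤
      ENNReal.ofReal (CK * c₂ * 4 ^ ν * CP) * (ENNReal.ofReal (σ * (4 * s)) *
        ((μ (ball x (σ * (4 * s))))⁻¹ * ∫⁻ y in ball x (σ * (4 * s)), g y ∂μ)) := by
  set A := {y | s < dist x y ∧ dist x y ≤ 2 * s}
  set B := ball x (4 * s)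
  set c := ⨍ z in B, f z ∂μ
  set k := ENNReal.ofReal (CK / s ^ ν)
  set G := (μ (ball x (σ * (4 * s))))⁻¹ * ∫⁻ y in ball x (σ * (4 * s)), g y ∂μ
  have hs4 : 0 < 4 * s := by positivity
  have hρ0 : 0 < ρ' := by linarith
  have hAB : A ⊆ B := annulus_subset_ball (by linarith)
  have hAm : MeasurableSet A := measurableSet_annulus x s (2 * s)
  have hB0 : μ B ≠ 0 := (hA.measure_ball_pos hc₁ x hs4).ne'
  have hB1 : μ B ≠ ∞ := (hA.measure_ball_lt_top x _).ne
  have hKint : IntegrableOn (K x) A μ := hA.integrableOn_kernel hν hK hCK hsize x hs _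
  have hsub : IntegrableOn (fun y => K x y * f y - K x y * c) A μ :=
    Integrable.sub hint (hKint.mul_const c)
  have heq : ∫ y in A, K x y * f y ∂μ = ∫ y in A, (K x y * f y - K x y * c) ∂μ := by
    rw [integral_sub hint (hKint.mul_const c), integral_mul_const,
      hA.integral_kernel_eq_zero hν hK hCK hsize hnull x hs (by linarith), zero_mul, sub_zero]
  have hpt : ∀ y ∈ A, ‖K x y * f y - K x y * c‖ₑ ^ ρ' ≤
      k ^ ρ' * ENNReal.ofReal (|f y - c| ^ ρ') := fun y hy => by
    rw [← ENNReal.ofReal_rpow_of_nonneg (abs_nonneg _) hρ0.le,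
      ← ENNReal.mul_rpow_of_nonneg _ _ hρ0.le, ← mul_sub, enorm_mul, Real.enorm_eq_ofReal_abs,
      Real.enorm_eq_ofReal_abs]
    gcongr
    exact ENNReal.ofReal_le_ofReal (hsize.abs_le hCK hν hs hy.1)
  have hHolder := ENNReal.lintegral_mul_le_Lp_mul_Lq (μ.restrict A)
    (Real.HolderConjugate.conjExponent hρ') hsub.aestronglyMeasurable.enorm (g := fun _ => 1)
    aemeasurable_const
  simp only [Pi.mul_apply, mul_one, ENNReal.one_rpow, lintegral_const, one_mul,
    Measure.restrict_apply MeasurableSet.univ, Set.univ_inter] at hHolder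
  have hB2 : (μ B) ^ (1 / ρ') * (μ B) ^ (1 / ρ'.conjExponent) = μ B := by
    rw [← ENNReal.rpow_add _ _ hB0 hB1]
    convert ENNReal.rpow_one (μ B) using 2
    have : ρ' - 1 ≠ 0 := by linarith
    rw [Real.conjExponent]
    field_simp
    ring
  have hexp : 0 ≤ 1 / ρ'.conjExponent := (Real.HolderConjugate.conjExponent hρ').symm.one_div_nonneg
  calc ‖∫ y in A, K x y * f y ∂μ‖ₑ
      ≤ ∫⁻ y in A, ‖K x y * f y - K x y * c‖ₑ ∂μ := by
        rw [heq]; exact enorm_integral_le_lintegral_enorm _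
    _ ≤ (k ^ ρ' * ∫⁻ y in B, ENNReal.ofReal (|f y - c| ^ ρ') ∂μ) ^ (1 / ρ') *
          μ B ^ (1 / ρ'.conjExponent) := by
        refine hHolder.trans ?_
        gcongr
        refine (setLIntegral_mono' hAm hpt).trans ?_
        rw [lintegral_const_mul' _ _ (ENNReal.rpow_ne_top_of_nonneg hρ0.le ofReal_ne_top)]
        gcongr
    _ = k * μ B * ((μ B)⁻¹ * ∫⁻ y in B, ENNReal.ofReal (|f y - c| ^ ρ') ∂μ) ^ (1 / ρ') := by
        set I := ∫⁻ y in B, ENNReal.ofReal (|f y - c| ^ ρ') ∂μ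
        have hI : I = μ B * ((μ B)⁻¹ * I) := by
          rw [← mul_assoc, ENNReal.mul_inv_cancel hB0 hB1, one_mul]
        conv_lhs => rw [hI]
        rw [ENNReal.mul_rpow_of_nonneg _ _ (by positivity),
          ENNReal.mul_rpow_of_nonneg _ _ (by positivity), ← ENNReal.rpow_mul,
          mul_one_div_cancel hρ0.ne', ENNReal.rpow_one]
        generalize ((μ B)⁻¹ * I) ^ (1 / ρ') = J
        rw [show k * μ B * J = k * (μ B ^ (1 / ρ') * μ B ^ (1 / ρ'.conjExponent)) * J by rw [hB2]]
        ring
    _ ≤ k * μ B * (ENNReal.ofReal (CP * (4 * s)) * G) := by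
        gcongr
        exact hPS x _ hs4
    _ ≤ k * ENNReal.ofReal (c₂ * (4 * s) ^ ν) * (ENNReal.ofReal (CP * (4 * s)) * G) := by
        gcongr
        exact (hA x _ hs4).2
    _ = ENNReal.ofReal (CK * c₂ * 4 ^ ν * CP) * (ENNReal.ofReal (4 * s) * G) := by
        clear_value G
        simp only [k]
        rw [← mul_assoc _ (ENNReal.ofReal (CP * (4 * s))) G, ← mul_assoc _ (ENNReal.ofReal (4 * s)) G,
          ← ENNReal.ofReal_mul (by positivity), ← ENNReal.ofReal_mul (by positivity),
          ← ENNReal.ofReal_mul (by positivity)]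
        congr 2
        rw [Real.mul_rpow (by norm_num) hs.le]
        field_simp
    _ ≤ _ := by
        exact mul_le_mul' le_rfl
          (mul_le_mul' (ENNReal.ofReal_le_ofReal (le_mul_of_one_le_left hs4.le hσ)) le_rfl)

theorem iUnion_dyadic_annulus (x : X) {ε : ℝ} (hε : 0 < ε) :
    ⋃ j : ℕ, {y | 2 ^ j * ε < dist x y ∧ dist x y ≤ 2 * (2 ^ j * ε)} = {y | ε < dist x y} := by
  ext y
  simp only [Set.mem_iUnion, Set.mem_ofPred_eq]
  constructor
  · rintro ⟨j, hj, -⟩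
    refine lt_of_le_of_lt ?_ hj
    exact le_mul_of_one_le_left hε.le (one_le_pow₀ one_le_two)
  · intro h
    obtain ⟨n, hn, hn'⟩ := exists_mem_Ioc_zpow (div_pos (hε.trans h) hε) (one_lt_two (α := ℝ))
    have hn0 : 0 ≤ n := by
      by_contra! hneg
      have h1 : (2 : ℝ) ^ (n + 1) ≤ 1 := zpow_le_one_of_nonpos₀ one_le_two (by omega)
      exact absurd ((one_lt_div hε).2 h) (not_lt.2 (hn'.trans h1))
    lift n to ℕ using hn0
    refine ⟨n, ?_, ?_⟩
    · rw [lt_div_iff₀ hε] at hn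
      exact_mod_cast hn
    · rw [div_le_iff₀ hε] at hn'
      refine hn'.trans_eq ?_
      rw [zpow_add_one₀ two_ne_zero, zpow_natCast]
      ring

theorem pairwise_disjoint_dyadic_annulus (x : X) {ε : ℝ} (hε : 0 < ε) :
    Pairwise (Function.onFun Disjoint
      fun j : ℕ => {y | 2 ^ j * ε < dist x y ∧ dist x y ≤ 2 * (2 ^ j * ε)}) := by
  have hmono : Monotone fun j : ℕ => (2 : ℝ) ^ j * ε := fun i j hij => by
    exact mul_le_mul_of_nonneg_right (pow_le_pow_right₀ one_le_two hij) hε.le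
  intro i j hij
  have := (hmono.pairwise_disjoint_on_Ioc_succ hij).preimage fun y => dist x y
  simp only [Nat.succ_eq_succ, Nat.succ_eq_add_one, pow_succ', mul_assoc] at this
  exact this

theorem PoincareSobolev.enorm_truncT_le {f : X → ℝ} {g : X → ℝ≥0∞} {ρ' CP σ : ℝ}
    (hPS : PoincareSobolev μ f g ρ' CP σ) (hA : IsAhlfors μ c₁ c₂ ν) (hc₁ : 0 < c₁) (hc₂ : 0 < c₂)
    (hν : 0 < ν) {K : X → X → ℝ} {CK : ℝ} (hK : Measurable (Function.uncurry K)) (hCK : 0 < CK)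
    (hsize : SizeCond K CK ν) (hnull : NullCond μ K) (hρ' : 1 < ρ') (hCP : 0 < CP) (hσ : 1 ≤ σ)
    (x : X) {ε : ℝ} (hε : 0 < ε) :
    ‖truncT μ K f ε x‖ₑ ≤ ENNReal.ofReal (CK * c₂ * 4 ^ ν * CP) *
      ∑' j : ℕ, ENNReal.ofReal (2 ^ j * (σ * 4 * ε)) *
        ((μ (ball x (2 ^ j * (σ * 4 * ε))))⁻¹ *
          ∫⁻ y in ball x (2 ^ j * (σ * 4 * ε)), g y ∂μ) := by
  unfold truncT
  by_cases hint : IntegrableOn (fun y => K x y * f y) {y | ε < dist x y} μ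
  swap
  · rw [integral_undef hint]
    simp
  rw [← iUnion_dyadic_annulus x hε] at hint ⊢
  rw [integral_iUnion (fun j => measurableSet_annulus x _ _)
    (pairwise_disjoint_dyadic_annulus x hε) hint, ← ENNReal.tsum_mul_left]
  refine enorm_tsum_le_tsum_enorm.trans (ENNReal.tsum_le_tsum fun j => ?_)
  have := hPS.enorm_integral_annulus_le hA hc₁ hc₂ hν hK hCK hsize hnull hρ' hCP hσ x
    (s := 2 ^ j * ε) (by positivity) (hint.mono_set (Set.subset_iUnion_of_subset j le_rfl))
  rwa [show σ * (4 * (2 ^ j * ε)) = 2 ^ j * (σ * 4 * ε) by ring] at this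

/-- A Hedberg type inequality for the maximal singular operator. -/
theorem PoincareSobolev.exists_maxT_le {f : X → ℝ} {g : X → ℝ≥0∞} {ρ' CP σ : ℝ}
    (hPS : PoincareSobolev μ f g ρ' CP σ) (hA : IsAhlfors μ c₁ c₂ ν) (hc₁ : 0 < c₁) (hc₂ : 0 < c₂)
    (hν : 0 < ν) {K : X → X → ℝ} {CK : ℝ} (hK : Measurable (Function.uncurry K)) (hCK : 0 < CK)
    (hsize : SizeCond K CK ν) (hnull : NullCond μ K) (hρ' : 1 < ρ') (hCP : 0 < CP) (hσ : 1 ≤ σ)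
    {p q : ℝ} (hp : 1 < p) (hpq : p ≤ q) (hqν : q / ν < 1) (hg : Measurable g)
    (hgM : morreyNorm μ p q g ≠ ∞) :
    ∃ C : ℝ≥0∞, C < ∞ ∧ ∀ x,
      maxT μ K f x ≤ C * (maximalFn μ g x ^ (1 - q / ν) * morreyNorm μ p q g ^ (q / ν)) := by
  have hq0 : 0 < q := by linarith
  obtain ⟨C, hC, hsum⟩ := exists_tsum_dyadic_le (a := ν / q)
    ((one_lt_div hq0).2 ((div_lt_one hν).1 hqν))
  simp only [one_div_div] at hsum
  set N := morreyNorm μ p q g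
  set k := ENNReal.ofReal c₁ ^ (-(1 / q))
  have hc0 : ENNReal.ofReal c₁ ≠ 0 := by simpa using hc₁
  have hk : k ≠ ∞ := ENNReal.rpow_ne_top_of_ne_zero hc0 ofReal_ne_top
  have hqν0 : 0 ≤ q / ν := by positivity
  refine ⟨ENNReal.ofReal (CK * c₂ * 4 ^ ν * CP) * C * k ^ (q / ν), by finiteness, fun x => ?_⟩
  refine iSup₂_le fun ε hε => ?_
  rw [← Real.enorm_eq_ofReal_abs]
  refine (hPS.enorm_truncT_le hA hc₁ hc₂ hν hK hCK hsize hnull hρ' hCP hσ x hε).trans ?_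
  have ht : 0 < σ * 4 * ε := by positivity
  have hr : ∀ j : ℕ, 0 < 2 ^ j * (σ * 4 * ε) := fun j => by positivity
  have hrE : ∀ j : ℕ, ENNReal.ofReal (2 ^ j * (σ * 4 * ε)) =
      2 ^ j * ENNReal.ofReal (σ * 4 * ε) := fun j => by
    rw [ENNReal.ofReal_mul (by positivity), ENNReal.ofReal_pow zero_le_two, ENNReal.ofReal_ofNat]
  have hbound := hsum (fun j => (μ (ball x (2 ^ j * (σ * 4 * ε))))⁻¹ *
      ∫⁻ y in ball x (2 ^ j * (σ * 4 * ε)), g y ∂μ) (maximalFn μ g x) (N * k)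
    (ENNReal.ofReal (σ * 4 * ε)) (ENNReal.mul_ne_top hgM hk) (by simpa using ht) ofReal_ne_top
    (fun j => le_iSup₂_of_le x _ (le_iSup₂_of_le (hr j) (mem_ball_self (hr j)) le_rfl))
    (fun j => by
      refine (laverage_le_morreyNorm (q := q) hA hc₁ hp hg x (hr j)).trans ?_
      rw [mul_assoc N k]
      refine mul_le_mul_right ?_ N
      have hlow : ENNReal.ofReal c₁ * (2 ^ j * ENNReal.ofReal (σ * 4 * ε)) ^ ν ≤
          μ (ball x (2 ^ j * (σ * 4 * ε))) := by
        refine le_trans (le_of_eq ?_) (hA x _ (hr j)).1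
        rw [← hrE, ENNReal.ofReal_rpow_of_pos (hr j), ← ENNReal.ofReal_mul hc₁.le]
      calc μ (ball x (2 ^ j * (σ * 4 * ε))) ^ (-(1 / q))
          ≤ (ENNReal.ofReal c₁ * (2 ^ j * ENNReal.ofReal (σ * 4 * ε)) ^ ν) ^ (-(1 / q)) := by
            rw [ENNReal.rpow_neg, ENNReal.rpow_neg]
            exact ENNReal.inv_le_inv.2 (ENNReal.rpow_le_rpow hlow (by positivity))
        _ = k * (2 ^ j * ENNReal.ofReal (σ * 4 * ε)) ^ (-(ν / q)) := by
            rw [ENNReal.mul_rpow_of_ne_top ofReal_ne_top (by finiteness), ← ENNReal.rpow_mul]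
            congr 2
            ring)
  simp only [hrE]
  calc _ ≤ ENNReal.ofReal (CK * c₂ * 4 ^ ν * CP) *
        (C * (maximalFn μ g x ^ (1 - q / ν) * (N * k) ^ (q / ν))) := by
        gcongr
    _ = _ := by rw [ENNReal.mul_rpow_of_nonneg _ _ hqν0]; ring

theorem morreyNorm_le_of_le_rpow {p q θ : ℝ} (hp : 0 < p) (hθ : 0 < θ)
    {F G : X → ℝ≥0∞} {C : ℝ≥0∞} (hC : C ≠ ∞) (h : ∀ x, F x ≤ C * G x ^ θ) :
    morreyNorm μ (p / θ) (q / θ) F ≤ C * morreyNorm μ p q G ^ θ := by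
  refine iSup₂_le fun z r => iSup_le fun hr => ?_
  have hpθ : 0 < p / θ := by positivity
  have hpt : ∀ x, F x ^ (p / θ) ≤ C ^ (p / θ) * G x ^ p := fun x => by
    refine (ENNReal.rpow_le_rpow (h x) hpθ.le).trans_eq ?_
    rw [ENNReal.mul_rpow_of_nonneg _ _ hpθ.le, ← ENNReal.rpow_mul, mul_div_cancel₀ _ hθ.ne']
  rw [div_div_div_cancel_right₀ hθ.ne', one_div_div]
  calc (μ (ball z r) ^ (p / q - 1) * ∫⁻ y in ball z r, F y ^ (p / θ) ∂μ) ^ (θ / p)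
      ≤ (μ (ball z r) ^ (p / q - 1) * ∫⁻ y in ball z r, C ^ (p / θ) * G y ^ p ∂μ) ^ (θ / p) := by
        gcongr with y
        exact hpt y
    _ = C * ((μ (ball z r) ^ (p / q - 1) * ∫⁻ y in ball z r, G y ^ p ∂μ) ^ (1 / p)) ^ θ := by
        rw [lintegral_const_mul' _ _ (ENNReal.rpow_ne_top_of_nonneg hpθ.le hC), mul_left_comm,
          ENNReal.mul_rpow_of_nonneg _ _ (by positivity), ← ENNReal.rpow_mul, ← ENNReal.rpow_mul,
          div_mul_div_cancel₀ hθ.ne', div_self hp.ne', ENNReal.rpow_one, one_div_mul_eq_div]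
    _ ≤ _ := by
        gcongr
        exact le_iSup₂_of_le z r (le_iSup_of_le hr le_rfl)

end Ahlfors

/-- Morrey-to-Morrey boundedness: with `p₁ = p/(1-q/ν)` and
`q₁ = q/(1-q/ν)`, `‖T^*_K f‖_{M^{p₁,q₁}} ≤ C ‖g‖_{M^{p,q}}`. -/
theorem morrey_to_morrey_boundedness
    (μ : Measure X) (c₁ c₂ ν CK CP σ ρ' : ℝ) (K : X → X → ℝ) (f : X → ℝ) (g : X → ℝ≥0∞)
    (hc₁ : 0 < c₁) (hc₁₂ : c₁ ≤ c₂) (hν : 0 < ν) (hA : IsAhlfors μ c₁ c₂ ν)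
    (hbal : (2 : ℝ) ^ (1 - ν) * (c₂ / c₁) < 1)
    (hK : Measurable (Function.uncurry K)) (hCK : 0 < CK)
    (hsize : SizeCond K CK ν) (hnull : NullCond μ K)
    (hf : LocallyIntegrable f μ) (hg : LocIntE μ g)
    (hρ'1 : 1 < ρ') (hρ'ν : ρ' < ν) (hCP : 0 < CP) (hσ : 1 ≤ σ)
    (hPS : PoincareSobolev μ f g ρ' CP σ)
    (p q : ℝ) (hp : 1 < p) (hpq : p ≤ q) (hqν : q / ν < 1)
    (hgM : morreyNorm μ p q g < ∞) :
    ∃ C : ℝ, 0 < C ∧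
      morreyNorm μ (p / (1 - q / ν)) (q / (1 - q / ν)) (maxT μ K f) ≤
        ENNReal.ofReal C * morreyNorm μ p q g := by
  have hc₂ : 0 < c₂ := hc₁.trans_le hc₁₂
  have hqν0 : 0 ≤ q / ν := div_nonneg (by linarith) hν.le
  have hθ : 0 < 1 - q / ν := by linarith
  obtain ⟨C, hC, hmaxT⟩ := hPS.exists_maxT_le hA hc₁ hc₂ hν hK hCK hsize hnull hρ'1 hCP hσ hp hpq
    hqν hg.1 hgM.ne
  obtain ⟨C', hC', hmax⟩ := hA.exists_morreyNorm_maximalFn_le hc₁ hc₂ hν hp hpq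
  set N := morreyNorm μ p q g
  have hD : C * C' ^ (1 - q / ν) ≠ ∞ := by finiteness
  refine ⟨(C * C' ^ (1 - q / ν)).toReal + 1, by positivity, ?_⟩
  calc morreyNorm μ (p / (1 - q / ν)) (q / (1 - q / ν)) (maxT μ K f)
      ≤ C * N ^ (q / ν) * morreyNorm μ p q (maximalFn μ g) ^ (1 - q / ν) :=
        morreyNorm_le_of_le_rpow (by linarith) hθ (by finiteness)
          fun x => (hmaxT x).trans_eq (by ring)
    _ ≤ C * N ^ (q / ν) * (C' * N) ^ (1 - q / ν) := by
        gcongr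
        exact hmax g hg.1
    _ = C * C' ^ (1 - q / ν) * (N ^ (q / ν) * N ^ (1 - q / ν)) := by
        rw [ENNReal.mul_rpow_of_nonneg _ _ hθ.le]; ring
    _ = C * C' ^ (1 - q / ν) * N := by
        rw [← ENNReal.rpow_add_of_nonneg _ _ hqν0 hθ.le, add_sub_cancel, ENNReal.rpow_one]
    _ ≤ _ := by
        gcongr
        rw [← ENNReal.ofReal_toReal hD]
        exact ENNReal.ofReal_le_ofReal (by simp)
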